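/- arXiv:2002.06992 — 10 statements merged into one kernel-verified Lean document; each statement's English description precedes it below -/
import Mathlib

section
/- Let 𝔣 > 0 and β > 0 be real numbers. Then there exists a unique x ∈ (0,β) such that 11·(β−x)² = 9·exp((β−x)·𝔣)·x²·(1 − 𝔣·(β−x)). Moreover this solution satisfies 𝔣·(β−x) < 1 (equivalently x > β − 1/𝔣). -/
/-- The function `s ↦ exp s * (1 - s)` is antitone on `[0, 1]`. -/
lemma exp_mul_one_sub_le {s t : ℝ} (hs : 0 ≤ s) (hst : s ≤ t) (ht : t ≤ 1) :
    Real.exp t * (1 - t) ≤ Real.exp s * (1 - s) := by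
  have h : 1 - t ≤ Real.exp (s - t) * (1 - s) := by
    nlinarith [mul_le_mul_of_nonneg_right (Real.add_one_le_exp (s - t))
      (sub_nonneg.2 (hst.trans ht)), mul_nonneg hs (sub_nonneg.2 hst)]
  calc
    Real.exp t * (1 - t) ≤ Real.exp t * (Real.exp (s - t) * (1 - s)) := by gcongr
    _ = Real.exp s * (1 - s) := by rw [← mul_assoc, ← Real.exp_add, add_sub_cancel]

/-- A solution of the first-order condition in `(0, β)` satisfies `𝔣 * (β - x) < 1`. -/
lemma mul_sub_lt_one_of_critical {𝔣 β x : ℝ} (hx : x ∈ Set.Ioo 0 β)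
    (h : 11 * (β - x) ^ 2 = 9 * Real.exp ((β - x) * 𝔣) * x ^ 2 * (1 - 𝔣 * (β - x))) :
    𝔣 * (β - x) < 1 := by
  have hx0 := hx.1
  have ht : 0 < β - x := sub_pos.2 hx.2
  have hpos : 0 < 9 * Real.exp ((β - x) * 𝔣) * x ^ 2 * (1 - 𝔣 * (β - x)) := by
    rw [← h]
    positivity
  exact sub_pos.1 (pos_of_mul_pos_right hpos (by positivity))

/-- Two solutions of the first-order condition in `(0, β)` cannot be strictly ordered. -/
lemma le_of_critical {𝔣 β x y : ℝ} (h𝔣 : 0 < 𝔣) (hx : x ∈ Set.Ioo 0 β) (hy : y ∈ Set.Ioo 0 β)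
    (ex : 11 * (β - x) ^ 2 = 9 * Real.exp ((β - x) * 𝔣) * x ^ 2 * (1 - 𝔣 * (β - x)))
    (ey : 11 * (β - y) ^ 2 = 9 * Real.exp ((β - y) * 𝔣) * y ^ 2 * (1 - 𝔣 * (β - y))) :
    y ≤ x := by
  by_contra! hxy
  have hx0 := hx.1
  have hy' : 0 < β - y := sub_pos.2 hy.2
  have hlt := mul_sub_lt_one_of_critical hx ex
  have hg : Real.exp (𝔣 * (β - x)) * (1 - 𝔣 * (β - x)) ≤
      Real.exp (𝔣 * (β - y)) * (1 - 𝔣 * (β - y)) :=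
    exp_mul_one_sub_le (by positivity) (by gcongr) hlt.le
  have hg0 : 0 ≤ Real.exp (𝔣 * (β - x)) * (1 - 𝔣 * (β - x)) :=
    mul_nonneg (Real.exp_pos _).le (sub_nonneg.2 hlt.le)
  have hsq : x ^ 2 ≤ y ^ 2 := by gcongr
  have hprod := mul_le_mul hsq hg hg0 (sq_nonneg y)
  have hlhs : (β - y) ^ 2 < (β - x) ^ 2 := by gcongr
  rw [mul_comm _ 𝔣] at ex ey
  linarith

/-- The first-order condition has a solution in `(0, β)`. -/
lemma exists_critical (𝔣 : ℝ) {β : ℝ} (hβ : 0 < β) :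
    ∃ x ∈ Set.Ioo 0 β,
      11 * (β - x) ^ 2 = 9 * Real.exp ((β - x) * 𝔣) * x ^ 2 * (1 - 𝔣 * (β - x)) := by
  let F : ℝ → ℝ := fun x =>
    11 * (β - x) ^ 2 - 9 * Real.exp ((β - x) * 𝔣) * x ^ 2 * (1 - 𝔣 * (β - x))
  have hF : ContinuousOn F (Set.Icc 0 β) := by fun_prop
  have h0 : (0 : ℝ) ∈ Set.Ioo (F β) (F 0) := by
    constructor <;> simp [F] <;> positivity
  obtain ⟨x, hx, hFx⟩ := intermediate_value_Ioo' hβ.le hF h0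
  exact ⟨x, hx, sub_eq_zero.1 hFx⟩

/-- Lemma 1.2, existence/uniqueness of the critical point.
Let `𝔣 > 0` and `β > 0`. There exists a unique `x ∈ (0,β)` satisfying
`11·(β−x)² = 9·exp((β−x)·𝔣)·x²·(1 − 𝔣·(β−x))`; moreover any such solution satisfies
`𝔣·(β−x) < 1` (equivalently `x > β − 1/𝔣`). -/
theorem bsvie_critical_point_exists_unique (𝔣 β : ℝ) (h𝔣 : 0 < 𝔣) (hβ : 0 < β) :
    (∃! x : ℝ, x ∈ Set.Ioo 0 β ∧
        11 * (β - x) ^ 2 = 9 * Real.exp ((β - x) * 𝔣) * x ^ 2 * (1 - 𝔣 * (β - x))) ∧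
    (∀ x ∈ Set.Ioo 0 β,
        11 * (β - x) ^ 2 = 9 * Real.exp ((β - x) * 𝔣) * x ^ 2 * (1 - 𝔣 * (β - x)) →
        𝔣 * (β - x) < 1 ∧ β - 1 / 𝔣 < x) := by
  obtain ⟨x, hx, ex⟩ := exists_critical 𝔣 hβ
  refine ⟨⟨x, ⟨hx, ex⟩, fun y ⟨hy, ey⟩ =>
    le_antisymm (le_of_critical h𝔣 hx hy ex ey) (le_of_critical h𝔣 hy hx ey ex)⟩, ?_⟩
  intro y hy ey
  have hlt := mul_sub_lt_one_of_critical hy ey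
  refine ⟨hlt, ?_⟩
  have := (lt_div_iff₀' h𝔣).2 hlt
  linarith
end

section
/- Let 𝔣 > 0 and β > 0 be real numbers, and suppose δ* ∈ (0,β) satisfies 11·(β−δ*)² = 9·exp((β−δ*)·𝔣)·(δ*)²·(1 − 𝔣·(β−δ*)). Then the infimum of Π^𝔣(γ,δ) over all pairs (γ,δ) with 0 < δ < γ ≤ β is attained at (β,δ*): for all reals γ, δ with 0 < δ < γ ≤ β one has Π^𝔣(γ,δ) ≥ Π^𝔣(β,δ*). -/
/-- The constant `Π^𝔣(γ,δ) = 11/δ + 9·exp((γ−δ)·𝔣)/(γ−δ)` of Lemma 1.2. -/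
noncomputable def PiConst (𝔣 γ δ : ℝ) : ℝ :=
  11 / δ + 9 * Real.exp ((γ - δ) * 𝔣) / (γ - δ)

/-- Tangent line bound for the convex function `x ↦ 1 / x` on the positive reals. -/
theorem one_div_sub_le_one_div {x y : ℝ} (hx : 0 < x) (hy : 0 < y) :
    1 / x - (y - x) / x ^ 2 ≤ 1 / y := by
  have h : 1 / y - (1 / x - (y - x) / x ^ 2) = (y - x) ^ 2 / (y * x ^ 2) := by
    field_simp
    ring
  have : 0 ≤ (y - x) ^ 2 / (y * x ^ 2) := by positivity
  linarith

/-- Tangent line bound for `x ↦ exp (x * a) / x` at a point where it is nonincreasing. -/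
theorem exp_mul_div_sub_le {a s t : ℝ} (hs : 0 < s) (ht : 0 < t) (has : a * s ≤ 1) :
    Real.exp (s * a) / s - Real.exp (s * a) * (1 - a * s) / s ^ 2 * (t - s) ≤
      Real.exp (t * a) / t := by
  have hexp : Real.exp (s * a) * (1 + a * (t - s)) ≤ Real.exp (t * a) := by
    have h : Real.exp (t * a) = Real.exp (s * a) * Real.exp (a * (t - s)) := by
      rw [← Real.exp_add]
      ring_nf
    rw [h]
    gcongr
    linarith [Real.add_one_le_exp (a * (t - s))]
  refine le_trans ?_ (div_le_div_of_nonneg_right hexp ht.le)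
  have h : Real.exp (s * a) * (1 + a * (t - s)) / t -
      (Real.exp (s * a) / s - Real.exp (s * a) * (1 - a * s) / s ^ 2 * (t - s)) =
      Real.exp (s * a) * (t - s) ^ 2 * (1 - a * s) / (t * s ^ 2) := by
    field_simp
    ring
  have h_one : 0 ≤ 1 - a * s := by linarith
  have : 0 ≤ Real.exp (s * a) * (t - s) ^ 2 * (1 - a * s) / (t * s ^ 2) := by positivity
  linarith

/-- Lemma 1.2, optimality over the whole domain. If `δ* ∈ (0,β)`
satisfies the first-order equation, then the infimum of `Π^𝔣(γ,δ)` over all pairs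
`0 < δ < γ ≤ β` is attained at `(β,δ*)`. -/
theorem bsvie_infimum_attained (𝔣 β δstar : ℝ) (h𝔣 : 0 < 𝔣) (hβ : 0 < β)
    (hmem : δstar ∈ Set.Ioo 0 β)
    (heq : 11 * (β - δstar) ^ 2 =
      9 * Real.exp ((β - δstar) * 𝔣) * δstar ^ 2 * (1 - 𝔣 * (β - δstar))) :
    ∀ γ δ : ℝ, 0 < δ → δ < γ → γ ≤ β → PiConst 𝔣 β δstar ≤ PiConst 𝔣 γ δ := by
  obtain ⟨hδ₀, hδβ⟩ := hmem
  intro γ δ hδ hδγ hγβ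
  have hs : 0 < β - δstar := sub_pos.mpr hδβ
  have ht : 0 < γ - δ := sub_pos.mpr hδγ
  have has : 0 < 1 - 𝔣 * (β - δstar) := by
    have hpos : 0 < 9 * Real.exp ((β - δstar) * 𝔣) * δstar ^ 2 * (1 - 𝔣 * (β - δstar)) := by
      rw [← heq]
      positivity
    exact pos_of_mul_pos_right hpos (by positivity)
  have hslope : 9 * (Real.exp ((β - δstar) * 𝔣) * (1 - 𝔣 * (β - δstar)) / (β - δstar) ^ 2) =
      11 / δstar ^ 2 := by
    rw [← mul_div_assoc, div_eq_div_iff (by positivity) (by positivity)]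
    linarith
  have hinv := one_div_sub_le_one_div hδ₀ hδ
  have hexp := exp_mul_div_sub_le (a := 𝔣) hs ht (by linarith)
  have hγ : 0 ≤ 11 / δstar ^ 2 * (β - γ) := mul_nonneg (by positivity) (by linarith)
  unfold PiConst
  calc 11 / δstar + 9 * Real.exp ((β - δstar) * 𝔣) / (β - δstar)
      ≤ 11 / δstar + 9 * Real.exp ((β - δstar) * 𝔣) / (β - δstar) +
          11 / δstar ^ 2 * (β - γ) := le_add_of_nonneg_right hγ
    _ = 11 * (1 / δstar - (δ - δstar) / δstar ^ 2) +
          9 * (Real.exp ((β - δstar) * 𝔣) / (β - δstar) -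
            Real.exp ((β - δstar) * 𝔣) * (1 - 𝔣 * (β - δstar)) / (β - δstar) ^ 2 *
              (γ - δ - (β - δstar))) := by
        linear_combination (γ - δ - (β - δstar)) * hslope
    _ ≤ 11 * (1 / δ) + 9 * (Real.exp ((γ - δ) * 𝔣) / (γ - δ)) := by gcongr
    _ = 11 / δ + 9 * Real.exp ((γ - δ) * 𝔣) / (γ - δ) := by ring
end

section
/- Let 𝔣 > 0 and let δ* be as in the context. Then lim_{β→+∞} (β − δ*(β)) = 1/𝔣. -/
/-- Lemma 1.2, asymptotics of the minimizer. If `δ*(β)` denotes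
the solution in `(0,β)` of the first-order equation, then `β − δ*(β) → 1/𝔣` as
`β → +∞`. -/
theorem bsvie_deltastar_asymptotics (𝔣 : ℝ) (h𝔣 : 0 < 𝔣) (δstar : ℝ → ℝ)
    (hδstar : ∀ β : ℝ, 0 < β → δstar β ∈ Set.Ioo 0 β ∧
      11 * (β - δstar β) ^ 2 =
        9 * Real.exp ((β - δstar β) * 𝔣) * (δstar β) ^ 2 * (1 - 𝔣 * (β - δstar β))) :
    Filter.Tendsto (fun β => β - δstar β) Filter.atTop (nhds (1 / 𝔣)) := by
  have upper : ∀ β, 0 < β → β - δstar β < 1 / 𝔣 := by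
    intro β hβ
    obtain ⟨⟨hx, hxβ⟩, h⟩ := hδstar β hβ
    have hy : 0 < β - δstar β := sub_pos.2 hxβ
    have hpos : 0 < 1 - 𝔣 * (β - δstar β) := by
      refine pos_of_mul_pos_right (a := 9 * Real.exp ((β - δstar β) * 𝔣) * (δstar β) ^ 2) ?_
        (by positivity)
      rw [← h]
      positivity
    rw [lt_div_iff₀ h𝔣]
    linarith
  have lower : ∀ β, 1 / 𝔣 < β →
      1 / 𝔣 - 11 / (9 * 𝔣 ^ 3) / (β - 1 / 𝔣) ^ 2 ≤ β - δstar β := by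
    intro β hβ
    have hβ0 : 0 < β := (one_div_pos.2 h𝔣).trans hβ
    obtain ⟨⟨hx, hxβ⟩, h⟩ := hδstar β hβ0
    have hu := upper β hβ0
    have hc : 0 < β - 1 / 𝔣 := sub_pos.2 hβ
    have hy : 0 < β - δstar β := sub_pos.2 hxβ
    have hgap : 0 ≤ 1 - 𝔣 * (β - δstar β) := by
      have := (lt_div_iff₀ h𝔣).1 hu
      linarith
    have hexp : 1 ≤ Real.exp ((β - δstar β) * 𝔣) := Real.one_le_exp (by positivity)
    have hbound : 9 * 1 * (β - 1 / 𝔣) ^ 2 * (1 - 𝔣 * (β - δstar β)) ≤ 11 * (1 / 𝔣) ^ 2 :=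
      calc
        _ ≤ 9 * Real.exp ((β - δstar β) * 𝔣) * (δstar β) ^ 2 * (1 - 𝔣 * (β - δstar β)) := by
          gcongr
          linarith
        _ = 11 * (β - δstar β) ^ 2 := h.symm
        _ ≤ _ := by gcongr
    have hdiff : 1 / 𝔣 - (β - δstar β) = (1 - 𝔣 * (β - δstar β)) / 𝔣 := by
      field_simp
    have hle : 1 / 𝔣 - (β - δstar β) ≤ 11 / (9 * 𝔣 ^ 3) / (β - 1 / 𝔣) ^ 2 := by
      rw [hdiff, le_div_iff₀ (by positivity)]
      calc
        _ = 9 * 1 * (β - 1 / 𝔣) ^ 2 * (1 - 𝔣 * (β - δstar β)) / (9 * 𝔣) := by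
          generalize β - 1 / 𝔣 = c
          field_simp
        _ ≤ 11 * (1 / 𝔣) ^ 2 / (9 * 𝔣) := by gcongr
        _ = _ := by field_simp
    linarith
  have hlim : Filter.Tendsto (fun β : ℝ => 1 / 𝔣 - 11 / (9 * 𝔣 ^ 3) / (β - 1 / 𝔣) ^ 2)
      Filter.atTop (nhds (1 / 𝔣)) := by
    have hsq : Filter.Tendsto (fun β : ℝ => (β - 1 / 𝔣) ^ 2) Filter.atTop Filter.atTop :=
      (Filter.tendsto_pow_atTop two_ne_zero).comp
        (Filter.tendsto_atTop_add_const_right _ (-(1 / 𝔣)) Filter.tendsto_id)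
    simpa using (hsq.const_div_atTop (11 / (9 * 𝔣 ^ 3))).const_sub (1 / 𝔣)
  refine tendsto_of_tendsto_of_tendsto_of_le_of_le' hlim tendsto_const_nhds ?_ ?_
  · filter_upwards [Filter.eventually_gt_atTop (1 / 𝔣)] with β hβ using lower β hβ
  · filter_upwards [Filter.eventually_gt_atTop 0] with β hβ using (upper β hβ).le
end

section
/- Let 𝔣 > 0 and let δ* be as in the context. Then lim_{β→+∞} M^𝔣(β) = 9·e·𝔣, where e = exp(1). -/
/-- The minimal constant `M^𝔣(β) = Π^𝔣(β,δ*(β)) = 11/δ*(β) + 9·exp((β−δ*(β))·𝔣)/(β−δ*(β))`. -/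
noncomputable def Mconst (𝔣 : ℝ) (δstar : ℝ → ℝ) (β : ℝ) : ℝ :=
  11 / δstar β + 9 * Real.exp ((β - δstar β) * 𝔣) / (β - δstar β)

/-- A positive point satisfying the first-order condition lies at distance less than `𝔣⁻¹`
below `β`, and the defect is of order `x⁻²`. -/
theorem first_order_condition_bounds {𝔣 β x : ℝ} (h𝔣 : 0 < 𝔣) (hx : x ∈ Set.Ioo 0 β)
    (h : 11 * (β - x) ^ 2 =
      9 * Real.exp ((β - x) * 𝔣) * x ^ 2 * (1 - 𝔣 * (β - x))) :
    (β - x) * 𝔣 < 1 ∧ 1 - 11 / (9 * 𝔣 ^ 2) * (x⁻¹) ^ 2 ≤ (β - x) * 𝔣 := by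
  obtain ⟨hx0, hxβ⟩ := hx
  have hy : 0 < β - x := sub_pos.2 hxβ
  have hexp : 1 ≤ Real.exp ((β - x) * 𝔣) := Real.one_le_exp (by positivity)
  have hgap : 0 < 1 - 𝔣 * (β - x) := by
    have hprod : 0 < 9 * Real.exp ((β - x) * 𝔣) * x ^ 2 * (1 - 𝔣 * (β - x)) := by
      rw [← h]; positivity
    exact pos_of_mul_pos_right hprod (by positivity)
  refine ⟨by linarith, ?_⟩
  have hle : 9 * x ^ 2 * (1 - 𝔣 * (β - x)) ≤ 11 * (β - x) ^ 2 := by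
    rw [h]
    gcongr
    linarith
  have hsq : (𝔣 * (β - x)) ^ 2 ≤ 1 := pow_le_one₀ (by positivity) (by linarith)
  have hbound : 1 - 𝔣 * (β - x) ≤ 11 / (9 * 𝔣 ^ 2 * x ^ 2) := by
    rw [le_div_iff₀ (by positivity)]
    have := mul_le_mul_of_nonneg_left hle (sq_nonneg 𝔣)
    nlinarith
  have heq : 11 / (9 * 𝔣 ^ 2) * (x⁻¹) ^ 2 = 11 / (9 * 𝔣 ^ 2 * x ^ 2) := by
    field_simp
  rw [heq]
  linarith

/-- Lemma 1.2, asymptotics of the minimal value.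
`M^𝔣(β) → 9·e·𝔣` as `β → +∞`. -/
theorem bsvie_Mconst_asymptotics (𝔣 : ℝ) (h𝔣 : 0 < 𝔣) (δstar : ℝ → ℝ)
    (hδstar : ∀ β : ℝ, 0 < β → δstar β ∈ Set.Ioo 0 β ∧
      11 * (β - δstar β) ^ 2 =
        9 * Real.exp ((β - δstar β) * 𝔣) * (δstar β) ^ 2 * (1 - 𝔣 * (β - δstar β))) :
    Filter.Tendsto (Mconst 𝔣 δstar) Filter.atTop (nhds (9 * Real.exp 1 * 𝔣)) := by
  have hev : ∀ᶠ β in Filter.atTop, (β - δstar β) * 𝔣 < 1 ∧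
      1 - 11 / (9 * 𝔣 ^ 2) * ((δstar β)⁻¹) ^ 2 ≤ (β - δstar β) * 𝔣 := by
    filter_upwards [Filter.eventually_gt_atTop 0] with β hβ
    exact first_order_condition_bounds h𝔣 (hδstar β hβ).1 (hδstar β hβ).2
  have hδ : Filter.Tendsto δstar Filter.atTop Filter.atTop := by
    refine Filter.tendsto_atTop_mono' _ ?_
      (Filter.tendsto_atTop_add_const_right Filter.atTop (-(1 / 𝔣)) Filter.tendsto_id)
    filter_upwards [hev] with β hβ
    have := (lt_div_iff₀ h𝔣).2 hβ.1
    simp only [id_eq]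
    linarith
  have hδinv : Filter.Tendsto (fun β => (δstar β)⁻¹) Filter.atTop (nhds 0) :=
    tendsto_inv_atTop_zero.comp hδ
  have hscaled : Filter.Tendsto (fun β => (β - δstar β) * 𝔣) Filter.atTop (nhds 1) := by
    have hlower : Filter.Tendsto (fun β => 1 - 11 / (9 * 𝔣 ^ 2) * ((δstar β)⁻¹) ^ 2)
        Filter.atTop (nhds 1) := by
      simpa using ((hδinv.pow 2).const_mul (11 / (9 * 𝔣 ^ 2))).const_sub 1
    exact tendsto_of_tendsto_of_tendsto_of_le_of_le' hlower tendsto_const_nhds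
      (hev.mono fun _ h => h.2) (hev.mono fun _ h => h.1.le)
  have hgap : Filter.Tendsto (fun β => β - δstar β) Filter.atTop (nhds 𝔣⁻¹) := by
    simpa [h𝔣.ne'] using hscaled.mul_const 𝔣⁻¹
  have hexp : Filter.Tendsto (fun β => Real.exp ((β - δstar β) * 𝔣)) Filter.atTop
      (nhds (Real.exp 1)) :=
    (Real.continuous_exp.tendsto 1).comp hscaled
  have hsum := (hδinv.const_mul 11).add
    ((hexp.const_mul 9).div hgap (inv_ne_zero h𝔣.ne'))
  unfold Mconst
  simpa [div_eq_mul_inv] using hsum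
end

section
/- Let 𝔣 > 0 with 18·e·𝔣 < 3·(√11 − 3) (e = exp(1)), and let δ* be as in the context. Then there exists β₀ > 0 such that for every β ≥ β₀ one has M^𝔣(β) < 1/2 and Σ̃^𝔣(β) < 1. -/
/-- The constant `Σ^𝔣(β) = 2·M^𝔣(β)/(1 − 2·M^𝔣(β))` of (1.12). -/
noncomputable def SigmaConst (𝔣 : ℝ) (δstar : ℝ → ℝ) (β : ℝ) : ℝ :=
  2 * Mconst 𝔣 δstar β / (1 - 2 * Mconst 𝔣 δstar β)

/-- The constant `Σ̃^𝔣(β) = Σ^𝔣(β)·exp((β−δ*(β))·𝔣)/(β−δ*(β))` of (1.12). -/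
noncomputable def SigmaTilde (𝔣 : ℝ) (δstar : ℝ → ℝ) (β : ℝ) : ℝ :=
  SigmaConst 𝔣 δstar β * Real.exp ((β - δstar β) * 𝔣) / (β - δstar β)

/-- A solution of the first-order condition stays within `1 / 𝔣` of `β`. -/
theorem sub_lt_inv_of_first_order {𝔣 β x : ℝ} (h𝔣 : 0 < 𝔣) (hx : x ∈ Set.Ioo 0 β)
    (h : 11 * (β - x) ^ 2 =
      9 * Real.exp ((β - x) * 𝔣) * x ^ 2 * (1 - 𝔣 * (β - x))) :
    β - x < 𝔣⁻¹ := by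
  have hy : 0 < β - x := sub_pos.2 hx.2
  have hpos : 0 < 9 * Real.exp ((β - x) * 𝔣) * x ^ 2 * (1 - 𝔣 * (β - x)) := by
    rw [← h]; positivity
  have h1 : 0 < 1 - 𝔣 * (β - x) := pos_of_mul_pos_right hpos (by positivity)
  rw [inv_eq_one_div, lt_div_iff₀ h𝔣]
  linarith

/-- A solution of the first-order condition satisfies `1 / 𝔣 - O(1 / x²) ≤ β - x`. -/
theorem inv_sub_le_of_first_order {𝔣 β x : ℝ} (h𝔣 : 0 < 𝔣) (hx : x ∈ Set.Ioo 0 β)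
    (h : 11 * (β - x) ^ 2 =
      9 * Real.exp ((β - x) * 𝔣) * x ^ 2 * (1 - 𝔣 * (β - x))) :
    𝔣⁻¹ - 11 / (9 * 𝔣 ^ 3) / x ^ 2 ≤ β - x := by
  have hlt := sub_lt_inv_of_first_order h𝔣 hx h
  have hy : 0 < β - x := sub_pos.2 hx.2
  have hx0 : 0 < x := hx.1
  generalize β - x = y at *
  have hfy : 𝔣 * y < 1 := by
    calc 𝔣 * y < 𝔣 * 𝔣⁻¹ := by gcongr
      _ = 1 := mul_inv_cancel₀ h𝔣.ne'
  have hexp : 1 ≤ Real.exp (y * 𝔣) := Real.one_le_exp (by positivity)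
  have hle : 9 * x ^ 2 * (1 - 𝔣 * y) ≤ 11 * y ^ 2 := by
    rw [h]
    have : 0 ≤ 9 * x ^ 2 * (1 - 𝔣 * y) := mul_nonneg (by positivity) (by linarith)
    nlinarith
  have hsq : (𝔣 * y) ^ 2 ≤ 1 := pow_le_one₀ (by positivity) hfy.le
  have hmul : 𝔣 ^ 2 * (9 * x ^ 2 * (1 - 𝔣 * y)) ≤ 11 := by
    have := mul_le_mul_of_nonneg_left hle (sq_nonneg 𝔣)
    nlinarith
  have key : 𝔣⁻¹ - y ≤ 11 / (9 * 𝔣 ^ 3) / x ^ 2 := by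
    rw [div_div, le_div_iff₀ (by positivity)]
    calc (𝔣⁻¹ - y) * (9 * 𝔣 ^ 3 * x ^ 2) = 𝔣 ^ 2 * (9 * x ^ 2 * (1 - 𝔣 * y)) := by
          field_simp
      _ ≤ 11 := hmul
  linarith

open Filter Topology in
/-- Remark 2.6. If `18·e·𝔣 < 3·(√11 − 3)`, then for all large `β`
one has `M^𝔣(β) < 1/2` and `Σ̃^𝔣(β) < 1`. -/
theorem bsvie_typeI_condition_large_beta (𝔣 : ℝ) (h𝔣 : 0 < 𝔣)
    (h18 : 18 * Real.exp 1 * 𝔣 < 3 * (Real.sqrt 11 - 3)) (δstar : ℝ → ℝ)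
    (hδstar : ∀ β : ℝ, 0 < β → δstar β ∈ Set.Ioo 0 β ∧
      11 * (β - δstar β) ^ 2 =
        9 * Real.exp ((β - δstar β) * 𝔣) * (δstar β) ^ 2 * (1 - 𝔣 * (β - δstar β))) :
    ∃ β₀ : ℝ, 0 < β₀ ∧ ∀ β ≥ β₀,
      Mconst 𝔣 δstar β < 1 / 2 ∧ SigmaTilde 𝔣 δstar β < 1 := by
  have hx : Tendsto δstar atTop atTop := by
    refine tendsto_atTop_mono' _ ?_ (tendsto_atTop_add_const_right atTop (-𝔣⁻¹) tendsto_id)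
    filter_upwards [eventually_gt_atTop 0] with β hβ
    have := sub_lt_inv_of_first_order h𝔣 (hδstar β hβ).1 (hδstar β hβ).2
    simp only [id]
    linarith
  have hy : Tendsto (fun β => β - δstar β) atTop (𝓝 𝔣⁻¹) := by
    have hlow : Tendsto (fun β => 𝔣⁻¹ - 11 / (9 * 𝔣 ^ 3) / δstar β ^ 2) atTop (𝓝 𝔣⁻¹) := by
      simpa using (tendsto_const_nhds (x := 𝔣⁻¹)).sub
        (((tendsto_pow_atTop two_ne_zero).comp hx).const_div_atTop (11 / (9 * 𝔣 ^ 3)))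
    refine tendsto_of_tendsto_of_tendsto_of_le_of_le' hlow tendsto_const_nhds ?_ ?_
    · filter_upwards [eventually_gt_atTop 0] with β hβ
      exact inv_sub_le_of_first_order h𝔣 (hδstar β hβ).1 (hδstar β hβ).2
    · filter_upwards [eventually_gt_atTop 0] with β hβ
      exact (sub_lt_inv_of_first_order h𝔣 (hδstar β hβ).1 (hδstar β hβ).2).le
  have hexp : Tendsto (fun β => Real.exp ((β - δstar β) * 𝔣)) atTop (𝓝 (Real.exp 1)) := by
    have := (hy.mul_const 𝔣).rexp
    rwa [inv_mul_cancel₀ h𝔣.ne'] at this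
  have hM : Tendsto (Mconst 𝔣 δstar) atTop (𝓝 (9 * Real.exp 1 * 𝔣)) := by
    have := (hx.const_div_atTop 11).add ((hexp.const_mul 9).div hy (inv_ne_zero h𝔣.ne'))
    rwa [zero_add, div_inv_eq_mul] at this
  have hs : 0 < 18 * Real.exp 1 * 𝔣 := by positivity
  have hsqrt : Real.sqrt 11 ^ 2 = 11 := Real.sq_sqrt (by norm_num)
  have hsqrt0 : 0 ≤ Real.sqrt 11 := Real.sqrt_nonneg 11
  have hs1 : 18 * Real.exp 1 * 𝔣 < 1 := by nlinarith
  have hquad : (18 * Real.exp 1 * 𝔣) ^ 2 < 18 * (1 - 18 * Real.exp 1 * 𝔣) := by nlinarith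
  have hden : 0 < 1 - 2 * (9 * Real.exp 1 * 𝔣) := by linarith
  have hS : Tendsto (SigmaTilde 𝔣 δstar) atTop
      (𝓝 (2 * (9 * Real.exp 1 * 𝔣) / (1 - 2 * (9 * Real.exp 1 * 𝔣)) *
        Real.exp 1 / 𝔣⁻¹)) :=
    (((hM.const_mul 2).div ((hM.const_mul 2).const_sub 1) hden.ne').mul hexp).div hy
      (inv_ne_zero h𝔣.ne')
  have hlim : 2 * (9 * Real.exp 1 * 𝔣) / (1 - 2 * (9 * Real.exp 1 * 𝔣)) *
      Real.exp 1 / 𝔣⁻¹ < 1 := by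
    rw [div_inv_eq_mul, div_mul_eq_mul_div, div_mul_eq_mul_div, div_lt_one hden]
    linarith
  obtain ⟨b, hb⟩ := eventually_atTop.1
    ((hM.eventually_lt_const (by linarith : 9 * Real.exp 1 * 𝔣 < 1 / 2)).and
      (hS.eventually_lt_const hlim))
  exact ⟨max b 1, by positivity, fun β hβ => hb β ((le_max_left b 1).trans hβ)⟩
end

section
/- Let 𝔣 > 0 and let δ* be as in the context. If 18·e·𝔣 < 1 (e = exp(1)), then there exists β₀ > 0 such that M^𝔣(β) < 1/2 for all β ≥ β₀; if 18·e·𝔣 > 1, then there exists β₀ > 0 such that M^𝔣(β) > 1/2 for all β ≥ β₀. -/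
open Filter Topology in
/-- The upper bound for `M^𝔣` at large `β`, as a function of a lower bound `D` for `δ*(β)`. -/
theorem tendsto_Mconst_upper_bound (a f : ℝ) :
    Tendsto (fun D : ℝ => 11 / D + a / (1 - 11 / (9 * f ^ 2) / D ^ 2)) atTop (𝓝 a) := by
  have h1 : Tendsto (fun D : ℝ => 11 / D) atTop (𝓝 0) := tendsto_const_nhds.div_atTop tendsto_id
  have h2 : Tendsto (fun D : ℝ => 11 / (9 * f ^ 2) / D ^ 2) atTop (𝓝 0) :=
    tendsto_const_nhds.div_atTop (tendsto_pow_atTop two_ne_zero)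
  have h3 : Tendsto (fun D : ℝ => a / (1 - 11 / (9 * f ^ 2) / D ^ 2)) atTop (𝓝 (a / (1 - 0))) :=
    tendsto_const_nhds.div (tendsto_const_nhds.sub h2) (by norm_num)
  simpa using h1.add h3

/-- A solution of the first-order condition satisfies `𝔣 * (β - δ) < 1`; here `y = β - δ`. -/
theorem mul_lt_one_of_first_order {f d y : ℝ} (hd : 0 < d) (hy : 0 < y)
    (h : 11 * y ^ 2 = 9 * Real.exp (y * f) * d ^ 2 * (1 - f * y)) : f * y < 1 := by
  have hpos : 0 < 9 * Real.exp (y * f) * d ^ 2 * (1 - f * y) := h ▸ by positivity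
  have := pos_of_mul_pos_right hpos (by positivity)
  linarith

/-- A solution of the first-order condition has `𝔣 * (β - δ)` close to `1` when `δ` is large. -/
theorem one_sub_le_mul_of_first_order {f d y D : ℝ} (hf : 0 < f) (hy : 0 < y)
    (hD : 0 < D) (hDd : D ≤ d)
    (h : 11 * y ^ 2 = 9 * Real.exp (y * f) * d ^ 2 * (1 - f * y)) :
    1 - 11 / (9 * f ^ 2) / D ^ 2 ≤ f * y := by
  have hlt := mul_lt_one_of_first_order (hD.trans_le hDd) hy h
  have hu : 0 ≤ 1 - f * y := by linarith
  have hexp : 1 ≤ Real.exp (y * f) := Real.one_le_exp (by positivity)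
  have hfy : (f * y) ^ 2 ≤ 1 := pow_le_one₀ (by positivity) hlt.le
  have hle : 9 * 1 * D ^ 2 * (1 - f * y) ≤ 11 * y ^ 2 := by
    rw [h]
    gcongr
  suffices 1 - f * y ≤ 11 / (9 * f ^ 2) / D ^ 2 by linarith
  rw [div_div, le_div_iff₀ (by positivity)]
  have := mul_le_mul_of_nonneg_left hle (sq_nonneg f)
  nlinarith


/-- Remark 2.6, `M`-part. If `18·e·𝔣 < 1` then `M^𝔣(β) < 1/2` for
all large `β`; if `18·e·𝔣 > 1` then `M^𝔣(β) > 1/2` for all large `β`. -/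
theorem bsvie_Mconst_half_dichotomy (𝔣 : ℝ) (h𝔣 : 0 < 𝔣) (δstar : ℝ → ℝ)
    (hδstar : ∀ β : ℝ, 0 < β → δstar β ∈ Set.Ioo 0 β ∧
      11 * (β - δstar β) ^ 2 =
        9 * Real.exp ((β - δstar β) * 𝔣) * (δstar β) ^ 2 * (1 - 𝔣 * (β - δstar β))) :
    (18 * Real.exp 1 * 𝔣 < 1 →
      ∃ β₀ : ℝ, 0 < β₀ ∧ ∀ β ≥ β₀, Mconst 𝔣 δstar β < 1 / 2) ∧
    (1 < 18 * Real.exp 1 * 𝔣 →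
      ∃ β₀ : ℝ, 0 < β₀ ∧ ∀ β ≥ β₀, 1 / 2 < Mconst 𝔣 δstar β) := by
  have hbasic : ∀ β : ℝ, 0 < β → 0 < δstar β ∧ 0 < β - δstar β ∧ 𝔣 * (β - δstar β) < 1 := by
    intro β hβ
    obtain ⟨⟨h1, h2⟩, h3⟩ := hδstar β hβ
    have hy : 0 < β - δstar β := sub_pos.2 h2
    exact ⟨h1, hy, mul_lt_one_of_first_order h1 hy h3⟩
  constructor
  · intro h
    have hev := (tendsto_Mconst_upper_bound (9 * Real.exp 1 * 𝔣) 𝔣).eventually_lt_const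
      (show 9 * Real.exp 1 * 𝔣 < 1 / 2 by linarith)
    have hev' : ∀ᶠ D : ℝ in Filter.atTop, 11 / (9 * 𝔣 ^ 2) / D ^ 2 < 1 :=
      (tendsto_const_nhds.div_atTop
        (Filter.tendsto_pow_atTop two_ne_zero)).eventually_lt_const one_pos
    obtain ⟨D₀, hD₀⟩ := Filter.eventually_atTop.1
      ((hev.and hev').and (Filter.eventually_gt_atTop 0))
    obtain ⟨⟨hM, hlt⟩, hpos⟩ := hD₀ D₀ le_rfl
    have hβ₀ : 0 < D₀ + 1 / 𝔣 := by positivity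
    refine ⟨D₀ + 1 / 𝔣, hβ₀, fun β hβ => ?_⟩
    have hβpos : 0 < β := hβ₀.trans_le hβ
    obtain ⟨hd, hy, hu⟩ := hbasic β hβpos
    have hfoc := (hδstar β hβpos).2
    have hDd : D₀ ≤ δstar β := by
      have : β - δstar β < 1 / 𝔣 := by rwa [lt_div_iff₀' h𝔣]
      linarith
    have hlow := one_sub_le_mul_of_first_order h𝔣 hy hpos hDd hfoc
    refine lt_of_le_of_lt ?_ hM
    unfold Mconst
    have hexp : Real.exp ((β - δstar β) * 𝔣) ≤ Real.exp 1 := Real.exp_le_exp.2 (by linarith)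
    have hsub : 0 < 1 - 11 / (9 * 𝔣 ^ 2) / D₀ ^ 2 := sub_pos.2 hlt
    refine add_le_add (by gcongr) ?_
    calc 9 * Real.exp ((β - δstar β) * 𝔣) / (β - δstar β)
        ≤ 9 * Real.exp 1 / (β - δstar β) := by gcongr
      _ = 9 * Real.exp 1 * 𝔣 / (𝔣 * (β - δstar β)) := by field_simp
      _ ≤ 9 * Real.exp 1 * 𝔣 / (1 - 11 / (9 * 𝔣 ^ 2) / D₀ ^ 2) := by gcongr
  · intro h
    refine ⟨1, one_pos, fun β hβ => ?_⟩
    obtain ⟨hd, hy, -⟩ := hbasic β (one_pos.trans_le hβ)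
    have hle : 9 * Real.exp 1 * 𝔣 ≤ 9 * Real.exp ((β - δstar β) * 𝔣) / (β - δstar β) := by
      rw [le_div_iff₀ hy]
      have := Real.exp_one_mul_le_exp (x := (β - δstar β) * 𝔣)
      linarith
    have : 0 < 11 / δstar β := by positivity
    unfold Mconst
    linarith
end

section
/- For every real 𝔣 > 0, lim_{δ→+∞} κ^𝔣(δ) = 9·e·𝔣 (e = exp(1)). Consequently, if 18·e·𝔣 < 1 then κ^𝔣(δ) < 1/2 for all sufficiently large δ, and if 18·e·𝔣 > 1 then κ^𝔣(δ) > 1/2 for all sufficiently large δ. -/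
/-- The constant `κ^𝔣(δ)` of (1.7) governing well-posedness of BSDEs in a general
filtration. -/
noncomputable def kappaConst (𝔣 δ : ℝ) : ℝ :=
  9 / δ + 𝔣 ^ 2 * (2 + 9 * δ) / (Real.sqrt (δ ^ 2 * 𝔣 ^ 2 + 4) - 2) *
    Real.exp ((δ * 𝔣 + 2 - Real.sqrt (δ ^ 2 * 𝔣 ^ 2 + 4)) / 2)

open Filter Topology in
/-- The gap between `√(x² + c)` and `x` vanishes at infinity. -/
theorem tendsto_sqrt_sq_add_sub_atTop {c : ℝ} (hc : 0 ≤ c) :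
    Tendsto (fun x : ℝ => √(x ^ 2 + c) - x) atTop (𝓝 0) := by
  have hbound : Tendsto (fun x : ℝ => c / x) atTop (𝓝 0) :=
    tendsto_const_nhds.div_atTop tendsto_id
  refine tendsto_of_tendsto_of_tendsto_of_le_of_le' tendsto_const_nhds hbound ?_ ?_
  · exact Eventually.of_forall fun x => sub_nonneg.2 (Real.le_sqrt_of_sq_le (by linarith))
  · filter_upwards [eventually_gt_atTop 0] with x hx
    rw [sub_le_iff_le_add]
    refine Real.sqrt_le_iff.2 ⟨by positivity, ?_⟩
    have h : (c / x + x) ^ 2 = (c / x) ^ 2 + 2 * c + x ^ 2 := by field_simp; ring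
    nlinarith [sq_nonneg (c / x)]

open Filter Topology in
theorem tendsto_kappaConst_atTop {𝔣 : ℝ} (h𝔣 : 0 < 𝔣) :
    Tendsto (kappaConst 𝔣) atTop (𝓝 (9 * Real.exp 1 * 𝔣)) := by
  have hgap : Tendsto (fun δ : ℝ => √((δ * 𝔣) ^ 2 + 4) - δ * 𝔣) atTop (𝓝 0) :=
    (tendsto_sqrt_sq_add_sub_atTop (by norm_num)).comp (tendsto_id.atTop_mul_const h𝔣)
  have hinv : Tendsto (fun δ : ℝ => δ⁻¹) atTop (𝓝 0) := tendsto_inv_atTop_zero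
  have hnum := ((hinv.const_mul 2).add_const 9).const_mul (𝔣 ^ 2)
  have hden := ((hgap.sub_const 2).mul hinv).const_add 𝔣
  have hexp := (Real.continuous_exp.tendsto _).comp ((hgap.const_sub 2).div_const 2)
  have hlim := (hinv.const_mul 9).add ((hnum.div hden (by simpa using h𝔣.ne')).mul hexp)
  have hval : 9 * 0 + 𝔣 ^ 2 * (2 * 0 + 9) / (𝔣 + (0 - 2) * 0) * Real.exp ((2 - 0) / 2)
      = 9 * Real.exp 1 * 𝔣 := by
    norm_num
    field_simp
  rw [hval] at hlim
  refine hlim.congr' ?_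
  filter_upwards [eventually_gt_atTop 0] with δ hδ
  have hfrac : 𝔣 ^ 2 * (2 * δ⁻¹ + 9) / (𝔣 + (√((δ * 𝔣) ^ 2 + 4) - δ * 𝔣 - 2) * δ⁻¹)
      = 𝔣 ^ 2 * (2 + 9 * δ) / (√((δ * 𝔣) ^ 2 + 4) - 2) := by
    rw [← mul_div_mul_right _ _ hδ.ne']
    congr 1
    · field_simp
    · field_simp
      ring
  simp only [kappaConst, Function.comp_apply, Pi.div_apply, ← mul_pow]
  rw [hfrac, div_eq_mul_inv 9 δ]
  congr 4
  ring

/-- Remark 2.6, `κ`-part. For every `𝔣 > 0`,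
`κ^𝔣(δ) → 9·e·𝔣` as `δ → +∞`; hence if `18·e·𝔣 < 1` then `κ^𝔣(δ) < 1/2` for all
large `δ`, and if `18·e·𝔣 > 1` then `κ^𝔣(δ) > 1/2` for all large `δ`. -/
theorem bsvie_kappa_asymptotics (𝔣 : ℝ) (h𝔣 : 0 < 𝔣) :
    Filter.Tendsto (kappaConst 𝔣) Filter.atTop (nhds (9 * Real.exp 1 * 𝔣)) ∧
    (18 * Real.exp 1 * 𝔣 < 1 → ∃ δ₀ : ℝ, ∀ δ ≥ δ₀, kappaConst 𝔣 δ < 1 / 2) ∧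
    (1 < 18 * Real.exp 1 * 𝔣 → ∃ δ₀ : ℝ, ∀ δ ≥ δ₀, 1 / 2 < kappaConst 𝔣 δ) := by
  have hlim := tendsto_kappaConst_atTop h𝔣
  refine ⟨hlim, fun h => ?_, fun h => ?_⟩
  · exact Filter.eventually_atTop.1 (hlim.eventually_lt_const (by linarith))
  · exact Filter.eventually_atTop.1 (hlim.eventually_const_lt (by linarith))
end

section
/- Let 𝔣 > 0 with e·𝔣 < 1/(3·(51+√2603)) (e = exp(1)), and let δ* be as in the context. Then there exists β₀ > 0 such that for every β ≥ β₀ one has: κ^𝔣(δ*(β)) < 1/2, M^𝔣(β) < 1/2, and (16 + exp((β−δ*(β))·𝔣)/(β−δ*(β)))·Σ^𝔣(β) < 1. -/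
open Filter Topology

/-- `√(u² + 4) − u → 0` as `u → ∞`. -/
lemma tendsto_sqrt_sq_add_four_sub_self :
    Tendsto (fun u : ℝ => Real.sqrt (u ^ 2 + 4) - u) atTop (𝓝 0) := by
  have h2 : Tendsto (fun u : ℝ => 2 / u) atTop (𝓝 0) := tendsto_const_nhds.div_atTop tendsto_id
  refine tendsto_of_tendsto_of_tendsto_of_le_of_le' tendsto_const_nhds h2 ?_ ?_
  · filter_upwards with u
    exact sub_nonneg.2 (Real.le_sqrt_of_sq_le (by linarith))
  · filter_upwards [eventually_gt_atTop 0] with u hu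
    rw [sub_le_iff_le_add, Real.sqrt_le_left (by positivity)]
    have : (2 / u + u) ^ 2 = u ^ 2 + 4 + (2 / u) ^ 2 := by field_simp; ring
    rw [this]
    linarith [sq_nonneg (2 / u)]

/-- `κ^𝔣(δ) → 9·e·𝔣` as `δ → ∞`. -/
lemma tendsto_kappaConst (𝔣 : ℝ) (h𝔣 : 0 < 𝔣) :
    Tendsto (kappaConst 𝔣) atTop (𝓝 (9 * (Real.exp 1 * 𝔣))) := by
  have hinv (c : ℝ) : Tendsto (fun δ : ℝ => c / δ) atTop (𝓝 0) :=
    tendsto_const_nhds.div_atTop tendsto_id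
  have hg : Tendsto (fun δ : ℝ => Real.sqrt ((δ * 𝔣) ^ 2 + 4) - δ * 𝔣) atTop (𝓝 0) :=
    tendsto_sqrt_sq_add_four_sub_self.comp (tendsto_id.atTop_mul_const h𝔣)
  have hexp : Tendsto (fun δ : ℝ => Real.exp ((2 - (Real.sqrt ((δ * 𝔣) ^ 2 + 4) - δ * 𝔣)) / 2))
      atTop (𝓝 (Real.exp ((2 - 0) / 2))) :=
    (Real.continuous_exp.tendsto _).comp ((tendsto_const_nhds.sub hg).div_const 2)
  have hden : Tendsto (fun δ : ℝ => 𝔣 + ((Real.sqrt ((δ * 𝔣) ^ 2 + 4) - δ * 𝔣) - 2) / δ)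
      atTop (𝓝 (𝔣 + 0)) :=
    tendsto_const_nhds.add ((hg.sub_const 2).div_atTop tendsto_id)
  have hfrac : Tendsto (fun δ : ℝ => 𝔣 ^ 2 * (2 / δ + 9) /
      (𝔣 + ((Real.sqrt ((δ * 𝔣) ^ 2 + 4) - δ * 𝔣) - 2) / δ))
      atTop (𝓝 (𝔣 ^ 2 * (0 + 9) / (𝔣 + 0))) :=
    (((hinv 2).add_const 9).const_mul _).div hden (by simpa using h𝔣.ne')
  have hlim : 0 + 𝔣 ^ 2 * (0 + 9) / (𝔣 + 0) * Real.exp ((2 - 0) / 2) =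
      9 * (Real.exp 1 * 𝔣) := by
    norm_num
    field_simp
  refine (hlim ▸ (hinv 9).add (hfrac.mul hexp)).congr' ?_
  filter_upwards [eventually_gt_atTop 0] with δ hδ
  have hnum : 𝔣 ^ 2 * (2 / δ + 9) = 𝔣 ^ 2 * (2 + 9 * δ) / δ := by field_simp
  have hden' : 𝔣 + ((Real.sqrt ((δ * 𝔣) ^ 2 + 4) - δ * 𝔣) - 2) / δ =
      (Real.sqrt ((δ * 𝔣) ^ 2 + 4) - 2) / δ := by field_simp; ring
  rw [hnum, hden', div_div_div_cancel_right₀ hδ.ne', kappaConst, mul_pow]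
  congr 3
  ring

/-- A solution of the first-order condition satisfies `(β − δ)·𝔣 < 1`. -/
lemma gap_mul_lt_one {𝔣 β δ : ℝ} (hδ : δ ∈ Set.Ioo 0 β)
    (h : 11 * (β - δ) ^ 2 =
      9 * Real.exp ((β - δ) * 𝔣) * δ ^ 2 * (1 - 𝔣 * (β - δ))) :
    𝔣 * (β - δ) < 1 := by
  have hs : 0 < β - δ := sub_pos.2 hδ.2
  have hδ0 := hδ.1
  have hpos : 0 < 9 * Real.exp ((β - δ) * 𝔣) * δ ^ 2 * (1 - 𝔣 * (β - δ)) := by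
    rw [← h]; positivity
  exact sub_pos.1 (pos_of_mul_pos_right hpos (by positivity))

/-- A solution of the first-order condition satisfies `1 − (β − δ)·𝔣 ≤ 11/(9𝔣²δ²)`. -/
lemma one_sub_gap_mul_le {𝔣 β δ : ℝ} (h𝔣 : 0 < 𝔣) (hδ : δ ∈ Set.Ioo 0 β)
    (h : 11 * (β - δ) ^ 2 =
      9 * Real.exp ((β - δ) * 𝔣) * δ ^ 2 * (1 - 𝔣 * (β - δ))) :
    1 - 𝔣 * (β - δ) ≤ 11 / (9 * 𝔣 ^ 2) / δ ^ 2 := by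
  have hs : 0 < β - δ := sub_pos.2 hδ.2
  have hδ0 := hδ.1
  have hlt := gap_mul_lt_one hδ h
  have hexp : 1 ≤ Real.exp ((β - δ) * 𝔣) := Real.one_le_exp (by positivity)
  have hsq : (𝔣 * (β - δ)) ^ 2 ≤ 1 := pow_le_one₀ (by positivity) hlt.le
  have hle : 9 * δ ^ 2 * (1 - 𝔣 * (β - δ)) ≤ 11 * (β - δ) ^ 2 := by
    have hnn : 0 ≤ 9 * δ ^ 2 * (1 - 𝔣 * (β - δ)) := mul_nonneg (by positivity) (by linarith)
    rw [h]
    nlinarith [mul_le_mul_of_nonneg_right hexp hnn]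
  rw [div_div, le_div_iff₀ (by positivity)]
  nlinarith [mul_le_mul_of_nonneg_left hle (sq_nonneg 𝔣)]

/-- well-posedness condition (4.1) for Type-II BSVIEs holds for
large `β`. If `e·𝔣 < 1/(3·(51+√2603))` then there is `β₀ > 0` such that for every
`β ≥ β₀`: `κ^𝔣(δ*(β)) < 1/2`, `M^𝔣(β) < 1/2`, and
`(16 + exp((β−δ*(β))·𝔣)/(β−δ*(β)))·Σ^𝔣(β) < 1`. -/
theorem bsvie_typeII_condition_large_beta (𝔣 : ℝ) (h𝔣 : 0 < 𝔣)
    (hsmall : Real.exp 1 * 𝔣 < 1 / (3 * (51 + Real.sqrt 2603))) (δstar : ℝ → ℝ)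
    (hδstar : ∀ β : ℝ, 0 < β → δstar β ∈ Set.Ioo 0 β ∧
      11 * (β - δstar β) ^ 2 =
        9 * Real.exp ((β - δstar β) * 𝔣) * (δstar β) ^ 2 * (1 - 𝔣 * (β - δstar β))) :
    ∃ β₀ : ℝ, 0 < β₀ ∧ ∀ β ≥ β₀,
      kappaConst 𝔣 (δstar β) < 1 / 2 ∧ Mconst 𝔣 δstar β < 1 / 2 ∧
      (16 + Real.exp ((β - δstar β) * 𝔣) / (β - δstar β)) * SigmaConst 𝔣 δstar β < 1 := by
  have hmem : ∀ᶠ β in atTop, 𝔣 * (β - δstar β) < 1 := by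
    filter_upwards [eventually_gt_atTop 0] with β hβ
    exact gap_mul_lt_one (hδstar β hβ).1 (hδstar β hβ).2
  have hδ : Tendsto δstar atTop atTop := by
    refine tendsto_atTop_mono' _ ?_ (tendsto_atTop_add_const_right atTop (-(1 / 𝔣)) tendsto_id)
    filter_upwards [hmem] with β h
    have : β - δstar β < 1 / 𝔣 := by rwa [lt_div_iff₀' h𝔣]
    simp only [id]
    linarith
  have hgap𝔣 : Tendsto (fun β => 1 - 𝔣 * (β - δstar β)) atTop (𝓝 0) := by
    refine tendsto_of_tendsto_of_tendsto_of_le_of_le' tendsto_const_nhds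
      ((tendsto_const_nhds (x := 11 / (9 * 𝔣 ^ 2))).div_atTop
        ((tendsto_pow_atTop two_ne_zero).comp hδ)) ?_ ?_
    · filter_upwards [hmem] with β h using by linarith
    · filter_upwards [eventually_gt_atTop 0] with β hβ
      exact one_sub_gap_mul_le h𝔣 (hδstar β hβ).1 (hδstar β hβ).2
  have hgap : Tendsto (fun β => (β - δstar β) * 𝔣) atTop (𝓝 1) := by
    have := hgap𝔣.const_sub 1
    rw [sub_zero] at this
    exact this.congr fun β => by ring
  have hratio : Tendsto (fun β => Real.exp ((β - δstar β) * 𝔣) / (β - δstar β)) atTop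
      (𝓝 (Real.exp 1 * 𝔣)) := by
    have h := (((Real.continuous_exp.tendsto 1).comp hgap).mul_const 𝔣).div hgap one_ne_zero
    rw [div_one] at h
    exact h.congr fun β => mul_div_mul_right _ _ h𝔣.ne'
  set y := Real.exp 1 * 𝔣 with hy
  have hM : Tendsto (Mconst 𝔣 δstar) atTop (𝓝 (9 * y)) := by
    have h := ((tendsto_const_nhds (x := (11 : ℝ))).div_atTop hδ).add (hratio.const_mul 9)
    rw [zero_add] at h
    exact h.congr fun β => by rw [Mconst, mul_div_assoc]
  have hκ : Tendsto (fun β => kappaConst 𝔣 (δstar β)) atTop (𝓝 (9 * y)) :=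
    (tendsto_kappaConst 𝔣 h𝔣).comp hδ
  have hy0 : 0 < y := by positivity
  have hr : Real.sqrt 2603 ^ 2 = 2603 := Real.sq_sqrt (by norm_num)
  have hr0 : 0 ≤ Real.sqrt 2603 := Real.sqrt_nonneg _
  have hsmall' : 6 * y + 51 < Real.sqrt 2603 := by
    rw [lt_div_iff₀ (by positivity)] at hsmall
    nlinarith
  have hquad : 18 * y ^ 2 + 306 * y < 1 := by nlinarith
  have hy18 : 18 * y < 1 := by nlinarith
  have hden : 0 < 1 - 2 * (9 * y) := by linarith
  have hS : Tendsto (fun β => (16 + Real.exp ((β - δstar β) * 𝔣) / (β - δstar β)) *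
      SigmaConst 𝔣 δstar β) atTop (𝓝 ((16 + y) * (2 * (9 * y) / (1 - 2 * (9 * y))))) :=
    (hratio.const_add 16).mul ((hM.const_mul 2).div ((hM.const_mul 2).const_sub 1) hden.ne')
  have hlim : (16 + y) * (2 * (9 * y) / (1 - 2 * (9 * y))) < 1 := by
    rw [← mul_div_assoc, div_lt_one hden]
    linarith
  obtain ⟨b, hb⟩ := eventually_atTop.1 <|
    (hκ.eventually_lt_const (by linarith : 9 * y < 1 / 2)).and <|
      (hM.eventually_lt_const (by linarith : 9 * y < 1 / 2)).and (hS.eventually_lt_const hlim)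
  exact ⟨max b 1, by positivity, fun β hβ => hb β (le_trans (le_max_left _ _) hβ)⟩
end

section
/- Let T > 0 and let A : [0,T] → ℝ be nondecreasing and right-continuous, with Lebesgue–Stieltjes measure μ_A. Then for every δ > 0, every t ∈ [0,T], and every measurable g : [0,T] → [0,∞], (∫_{(t,T]} g(s) dμ_A(s))² ≤ (1/δ)·exp(−δ·A(t))·∫_{(t,T]} exp(δ·A(s))·g(s)² dμ_A(s). -/
open MeasureTheory Set
open scoped ENNReal

/-- Cauchy–Schwarz for the Lebesgue integral of `ℝ≥0∞`-valued functions. -/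
lemma lintegral_mul_sq_le {α : Type*} [MeasurableSpace α] {μ : Measure α} {f g : α → ℝ≥0∞}
    (hf : AEMeasurable f μ) (hg : AEMeasurable g μ) :
    (∫⁻ x, f x * g x ∂μ) ^ 2 ≤ (∫⁻ x, f x ^ 2 ∂μ) * ∫⁻ x, g x ^ 2 ∂μ := by
  have h := ENNReal.lintegral_mul_le_Lp_mul_Lq μ Real.HolderConjugate.two_two hf hg
  have hsq : ∀ a : ℝ≥0∞, (a ^ (1 / 2 : ℝ)) ^ 2 = a := fun a => by
    rw [← ENNReal.rpow_natCast, ← ENNReal.rpow_mul]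
    norm_num
  calc (∫⁻ x, f x * g x ∂μ) ^ 2
      ≤ ((∫⁻ x, f x ^ (2 : ℝ) ∂μ) ^ (1 / 2 : ℝ) * (∫⁻ x, g x ^ (2 : ℝ) ∂μ) ^ (1 / 2 : ℝ)) ^ 2 :=
        pow_le_pow_left' h 2
    _ = _ := by simp only [mul_pow, hsq, ENNReal.rpow_two]

/-- A set of reals in `Ioi t` has measure at most `C` if every interval `Ioc t s` ending in it
does. -/
lemma measure_le_of_forall_measure_Ioc_le {μ : Measure ℝ} {t : ℝ} {C : ℝ≥0∞} {S : Set ℝ}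
    (hS : S ⊆ Ioi t) (hb : BddAbove S) (h : ∀ s ∈ S, μ (Ioc t s) ≤ C) : μ S ≤ C := by
  rcases S.eq_empty_or_nonempty with rfl | hne
  · simp
  by_cases hc : sSup S ∈ S
  · exact (measure_mono fun s hs => mem_Ioc.2 ⟨hS hs, le_csSup hb hs⟩).trans (h _ hc)
  obtain ⟨v, hv, hlim, hmem⟩ := exists_seq_tendsto_sSup hne hb
  have hsub : S ⊆ ⋃ n, Ioc t (v n) := fun s hs => by
    have hlt : s < sSup S := (le_csSup hb hs).lt_of_ne (fun e => hc (e ▸ hs))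
    obtain ⟨n, hn⟩ := (hlim.eventually_const_lt hlt).exists
    exact mem_iUnion.2 ⟨n, hS hs, hn.le⟩
  have hm : Monotone fun n => Ioc t (v n) := fun m n hmn => Ioc_subset_Ioc_right (hv hmn)
  refine (measure_mono hsub).trans ?_
  rw [hm.measure_iUnion]
  exact iSup_le fun n => h _ (hmem n)

lemma lintegral_Ioc_log_sub_log {c : ℝ} (hc : 0 < c) :
    ∫⁻ r in Ioc 0 c, ENNReal.ofReal (Real.log c - Real.log r) = ENNReal.ofReal c := by
  have hi : IntervalIntegrable (fun r => Real.log c - Real.log r) volume 0 c :=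
    intervalIntegrable_const.sub intervalIntegral.intervalIntegrable_log'
  rw [← ofReal_integral_eq_lintegral_ofReal
    ((intervalIntegrable_iff_integrableOn_Ioc_of_le hc.le).1 hi)]
  · rw [← intervalIntegral.integral_of_le hc.le,
      intervalIntegral.integral_sub intervalIntegrable_const
        intervalIntegral.intervalIntegrable_log']
    simp
  · filter_upwards [ae_restrict_mem measurableSet_Ioc] with r hr
    exact sub_nonneg.2 (Real.log_le_log hr.1 hr.2)

/-- For a Lebesgue–Stieltjes measure `dA`, one has `∫_{(t,T]} e^{-δ A} dA ≤ δ⁻¹ e^{-δ A(t)}`. -/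
lemma lintegral_exp_neg_stieltjes_le {A : ℝ → ℝ} {t T δ : ℝ} {μ : Measure ℝ}
    (hA : MonotoneOn A (Icc t T))
    (hμ : ∀ s ∈ Ioc t T, μ (Ioc t s) = ENNReal.ofReal (A s - A t)) (hδ : 0 < δ) :
    ∫⁻ s in Ioc t T, ENNReal.ofReal (Real.exp (-δ * A s)) ∂μ ≤
      ENNReal.ofReal (1 / δ * Real.exp (-δ * A t)) := by
  have hAm : AEMeasurable A (μ.restrict (Ioc t T)) :=
    aemeasurable_restrict_of_monotoneOn measurableSet_Ioc (hA.mono Ioc_subset_Icc_self)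
  have hle : ∀ s ∈ Ioc t T, A t ≤ A s := fun s hs =>
    hA ⟨le_rfl, hs.1.le.trans hs.2⟩ ⟨hs.1.le, hs.2⟩ hs.1.le
  set c := Real.exp (-δ * A t) with hc
  have hc0 : 0 < c := Real.exp_pos _
  rw [lintegral_eq_lintegral_meas_le _ (ae_of_all _ fun s => (Real.exp_pos _).le)
    (Real.measurable_exp.comp_aemeasurable (hAm.const_mul _))]
  have hlevel : ∀ r ∈ Ioi (0 : ℝ), μ.restrict (Ioc t T) {s | r ≤ Real.exp (-δ * A s)} ≤
      (Ioc 0 c).indicator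
        (fun r => ENNReal.ofReal (1 / δ) * ENNReal.ofReal (Real.log c - Real.log r)) r := by
    intro r hr
    rw [Measure.restrict_apply' measurableSet_Ioc]
    by_cases hrc : r ≤ c
    · rw [indicator_of_mem (show r ∈ Ioc 0 c from ⟨hr, hrc⟩)]
      refine measure_le_of_forall_measure_Ioc_le (fun s hs => hs.2.1)
        ⟨T, fun s hs => hs.2.2⟩ fun s hs => ?_
      rw [hμ s hs.2, ← ENNReal.ofReal_mul (by positivity)]
      refine ENNReal.ofReal_le_ofReal ?_
      have hlog : Real.log r ≤ -δ * A s := (Real.log_le_iff_le_exp hr).2 hs.1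
      rw [hc, Real.log_exp, one_div, inv_mul_eq_div, le_div_iff₀ hδ]
      linarith
    · have hempty : {s | r ≤ Real.exp (-δ * A s)} ∩ Ioc t T = ∅ := by
        refine eq_empty_of_forall_notMem fun s hs => hrc (le_trans hs.1 ?_)
        exact Real.exp_le_exp.2 (mul_le_mul_of_nonpos_left (hle s hs.2) (by linarith))
      rw [hempty, measure_empty]
      exact zero_le
  refine (setLIntegral_mono' measurableSet_Ioi hlevel).trans ?_
  refine (setLIntegral_le_lintegral _ _).trans ?_
  rw [lintegral_indicator measurableSet_Ioc, lintegral_const_mul' _ _ ENNReal.ofReal_ne_top,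
    lintegral_Ioc_log_sub_log hc0, ← ENNReal.ofReal_mul (by positivity)]

/-- pathwise Cauchy–Schwarz estimate used in Lemma 2.2.
Let `A : [0,T] → ℝ` be nondecreasing and right-continuous with Lebesgue–Stieltjes
measure `μ_A`. Then for every `δ > 0`, `t ∈ [0,T]` and measurable `g : [0,T] → [0,∞]`,
`(∫_{(t,T]} g dμ_A)² ≤ (1/δ)·e^{−δ·A(t)}·∫_{(t,T]} e^{δ·A(s)}·g(s)² dμ_A(s)`. -/
theorem bsvie_cauchy_schwarz_stieltjes (T : ℝ) (hT : 0 < T) (A : ℝ → ℝ)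
    (hmono : MonotoneOn A (Icc 0 T))
    (hrc : ∀ t ∈ Ico 0 T, ContinuousWithinAt A (Ici t) t)
    (μ : Measure ℝ)
    (hμ : ∀ a b : ℝ, 0 ≤ a → a ≤ b → b ≤ T →
      μ (Ioc a b) = ENNReal.ofReal (A b - A a))
    (δ : ℝ) (hδ : 0 < δ) (t : ℝ) (ht : t ∈ Icc 0 T)
    (g : ℝ → ℝ≥0∞) (hg : Measurable g) :
    (∫⁻ s in Ioc t T, g s ∂μ) ^ 2 ≤
      ENNReal.ofReal (1 / δ * Real.exp (-δ * A t)) *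
        ∫⁻ s in Ioc t T, ENNReal.ofReal (Real.exp (δ * A s)) * (g s) ^ 2 ∂μ := by
  have hAm : AEMeasurable A (μ.restrict (Ioc t T)) :=
    aemeasurable_restrict_of_monotoneOn measurableSet_Ioc
      (hmono.mono fun s hs => ⟨ht.1.trans hs.1.le, hs.2⟩)
  have hexp : ∀ k : ℝ, AEMeasurable (fun s => ENNReal.ofReal (Real.exp (k * A s)))
      (μ.restrict (Ioc t T)) := fun k =>
    (Real.measurable_exp.comp_aemeasurable (hAm.const_mul k)).ennreal_ofReal
  have hsq : ∀ k x : ℝ, ENNReal.ofReal (Real.exp (k / 2 * x)) ^ 2 =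
      ENNReal.ofReal (Real.exp (k * x)) := fun k x => by
    rw [← ENNReal.ofReal_pow (Real.exp_pos _).le, ← Real.exp_nat_mul]
    congr 2
    push_cast
    ring
  have hprod : ∀ s, ENNReal.ofReal (Real.exp (-δ / 2 * A s)) *
      (ENNReal.ofReal (Real.exp (δ / 2 * A s)) * g s) = g s := fun s => by
    rw [← mul_assoc, ← ENNReal.ofReal_mul (Real.exp_pos _).le, ← Real.exp_add,
      show -δ / 2 * A s + δ / 2 * A s = 0 by ring]
    simp
  have hCS := lintegral_mul_sq_le (hexp (-δ / 2)) ((hexp (δ / 2)).mul hg.aemeasurable)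
  simp only [Pi.mul_apply, hprod, mul_pow, hsq] at hCS
  refine hCS.trans (mul_le_mul_left ?_ _)
  exact lintegral_exp_neg_stieltjes_le (hmono.mono (Icc_subset_Icc_left ht.1))
    (fun s hs => hμ t s ht.1 hs.1.le hs.2) hδ
end

section
/- Let T > 0 and let A : [0,T] → ℝ be nondecreasing and right-continuous with all jumps bounded by 𝔣 > 0 (i.e. A(u) − A(u−) ≤ 𝔣 for every u ∈ (0,T]), and let μ_A be its Lebesgue–Stieltjes measure. Then for all reals γ > δ > 0 and every measurable φ : [0,T] → [0,∞], ∫_{(0,T]} exp((γ−δ)·A(t)) · (∫_{(t,T]} exp(δ·A(u))·φ(u) dμ_A(u)) dμ_A(t) ≤ (exp((γ−δ)·𝔣)/(γ−δ)) · ∫_{(0,T]} exp(γ·A(u))·φ(u) dμ_A(u). -/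
open MeasureTheory Set Function
open scoped ENNReal

/-- A function monotone on `[a, t]` exceeds, somewhere strictly between `a` and `t`, every value
lying below its left limit at `t`. -/
theorem MonotoneOn.exists_mem_Ioo_lt_of_lt_leftLim {f : ℝ → ℝ} {a t s : ℝ} (hat : a < t)
    (hf : MonotoneOn f (Icc a t)) (hs : s < leftLim f t) : ∃ r ∈ Ioo a t, s < f r := by
  have hbdd : BddAbove (f '' Ioo a t) := by
    refine ⟨f t, ?_⟩
    rintro _ ⟨r, hr, rfl⟩
    exact hf (Ioo_subset_Icc_self hr) (right_mem_Icc.2 hat.le) hr.2.le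
  have hlim : Filter.Tendsto f (nhdsWithin t (Iio t)) (nhds (leftLim f t)) :=
    tendsto_leftLim_of_tendsto ⟨_, MonotoneOn.tendsto_nhdsWithin_Ioo_left
      (nonempty_Ioo.2 hat) (hf.mono Ioo_subset_Icc_self) hbdd⟩
  obtain ⟨r, hr, hr'⟩ :=
    ((hlim.eventually (lt_mem_nhds hs)).and (Ioo_mem_nhdsLT hat)).exists
  exact ⟨r, hr', hr⟩

section LebesgueStieltjes

variable {T J : ℝ} {A : ℝ → ℝ} {μ : Measure ℝ}

/-- The law of `A - J` on `(0, u]` under the Lebesgue–Stieltjes measure of `A`, where `J` bounds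
the jumps of `A`, is stochastically dominated by Lebesgue measure on `(-∞, A u]`. -/
theorem measure_restrict_lt_sub_jump_le (hmono : MonotoneOn A (Icc 0 T))
    (hrc : ∀ t ∈ Ico 0 T, ContinuousWithinAt A (Ici t) t)
    (hjump : ∀ u ∈ Ioc 0 T, A u - leftLim A u ≤ J)
    (hμ : ∀ a b : ℝ, 0 ≤ a → a ≤ b → b ≤ T → μ (Ioc a b) = ENNReal.ofReal (A b - A a))
    {u : ℝ} (hu : u ∈ Ioc 0 T) (s : ℝ) :
    μ ({t | s < A t - J} ∩ Ioc 0 u) ≤ ENNReal.ofReal (A u - s) := by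
  set P : Set ℝ := {t | t ∈ Icc 0 u ∧ s < A t} with hP
  have hbdd : BddBelow P := ⟨0, fun t ht => ht.1.1⟩
  have hkey : ∀ t ∈ {t | s < A t - J} ∩ Ioc 0 u, ∃ r ∈ P, r < t := by
    rintro t ⟨hst, ht0, htu⟩
    have htT : t ≤ T := htu.trans hu.2
    have hlt : s < leftLim A t := by
      have := hjump t ⟨ht0, htT⟩
      simp only [mem_ofPred_eq] at hst
      linarith
    obtain ⟨r, hr, hsr⟩ := MonotoneOn.exists_mem_Ioo_lt_of_lt_leftLim ht0
      (hmono.mono (Icc_subset_Icc_right htT)) hlt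
    exact ⟨r, ⟨⟨hr.1.le, hr.2.le.trans htu⟩, hsr⟩, hr.2⟩
  rcases ({t | s < A t - J} ∩ Ioc 0 u).eq_empty_or_nonempty with hempty | ⟨t₀, ht₀⟩
  · simp [hempty]
  obtain ⟨r₀, hr₀, hrt₀⟩ := hkey t₀ ht₀
  have hτ0 : 0 ≤ sInf P := le_csInf ⟨r₀, hr₀⟩ fun t ht => ht.1.1
  have hτu : sInf P < u := (csInf_le hbdd hr₀).trans_lt (hrt₀.trans_le ht₀.2.2)
  have hsτ : s ≤ A (sInf P) := by
    have hlim : Filter.Tendsto A (nhdsWithin (sInf P) (Ioi (sInf P))) (nhds (A (sInf P))) :=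
      (hrc (sInf P) ⟨hτ0, hτu.trans_le hu.2⟩).mono_left
        (nhdsWithin_mono _ Ioi_subset_Ici_self)
    refine ge_of_tendsto hlim ?_
    filter_upwards [Ioo_mem_nhdsGT hτu] with r hr
    obtain ⟨p, hp, hpr⟩ := exists_lt_of_csInf_lt ⟨r₀, hr₀⟩ hr.1
    exact hp.2.le.trans (hmono ⟨hp.1.1, hp.1.2.trans hu.2⟩
      ⟨hτ0.trans hr.1.le, hr.2.le.trans hu.2⟩ hpr.le)
  calc μ ({t | s < A t - J} ∩ Ioc 0 u) ≤ μ (Ioc (sInf P) u) := by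
        refine measure_mono fun t ht => ?_
        obtain ⟨r, hr, hrt⟩ := hkey t ht
        exact ⟨(csInf_le hbdd hr).trans_lt hrt, ht.2.2⟩
    _ = ENNReal.ofReal (A u - A (sInf P)) := hμ _ _ hτ0 hτu.le hu.2
    _ ≤ ENNReal.ofReal (A u - s) := ENNReal.ofReal_le_ofReal (by linarith)

theorem lintegral_exp_mul_Iic {c : ℝ} (hc : 0 < c) (x : ℝ) :
    ∫⁻ y in Iic x, ENNReal.ofReal (Real.exp (c * y)) =
      ENNReal.ofReal (Real.exp (c * x) / c) := by
  rw [← ofReal_integral_eq_lintegral_ofReal (integrableOn_exp_mul_Iic hc x)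
    (Filter.Eventually.of_forall fun _ => (Real.exp_pos _).le), integral_exp_mul_Iic hc]

/-- The exponential of a Lebesgue–Stieltjes integrator `A` with jumps at most `J` satisfies
`∫_{(0,u]} e^{cA} dA ≤ (e^{cJ} / c) e^{cA(u)}`. -/
theorem lintegral_Ioc_exp_mul_le (hmono : MonotoneOn A (Icc 0 T))
    (hrc : ∀ t ∈ Ico 0 T, ContinuousWithinAt A (Ici t) t)
    (hjump : ∀ u ∈ Ioc 0 T, A u - leftLim A u ≤ J)
    (hμ : ∀ a b : ℝ, 0 ≤ a → a ≤ b → b ≤ T → μ (Ioc a b) = ENNReal.ofReal (A b - A a))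
    {c : ℝ} (hc : 0 < c) {u : ℝ} (hu : u ∈ Ioc 0 T) :
    ∫⁻ t in Ioc 0 u, ENNReal.ofReal (Real.exp (c * A t)) ∂μ ≤
      ENNReal.ofReal (Real.exp (c * J) / c) * ENNReal.ofReal (Real.exp (c * A u)) := by
  have hA : AEMeasurable A (μ.restrict (Ioc 0 u)) :=
    aemeasurable_restrict_of_monotoneOn measurableSet_Ioc
      (hmono.mono fun t ht => ⟨ht.1.le, ht.2.trans hu.2⟩)
  have hshift : ∫⁻ t in Ioc 0 u, ENNReal.ofReal (Real.exp (c * (A t - J))) ∂μ ≤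
      ENNReal.ofReal (Real.exp (c * A u) / c) := by
    rw [← lintegral_exp_mul_Iic hc,
      lintegral_eq_lintegral_meas_lt _ (Filter.Eventually.of_forall fun _ => (Real.exp_pos _).le)
        (Real.measurable_exp.comp_aemeasurable ((hA.sub_const J).const_mul c)),
      lintegral_eq_lintegral_meas_lt _ (Filter.Eventually.of_forall fun _ => (Real.exp_pos _).le)
        (by fun_prop)]
    refine setLIntegral_mono' measurableSet_Ioi fun r hr => ?_
    have hlevel : ∀ x : ℝ, r < Real.exp (c * x) ↔ Real.log r / c < x := fun x => by
      rw [← Real.log_lt_iff_lt_exp hr, div_lt_iff₀' hc]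
    simp only [hlevel]
    rw [Measure.restrict_apply' measurableSet_Ioc, Measure.restrict_apply' measurableSet_Iic]
    change _ ≤ volume (Ioc _ _)
    rw [Real.volume_Ioc]
    exact measure_restrict_lt_sub_jump_le hmono hrc hjump hμ hu _
  calc ∫⁻ t in Ioc 0 u, ENNReal.ofReal (Real.exp (c * A t)) ∂μ
      = ∫⁻ t in Ioc 0 u, ENNReal.ofReal (Real.exp (c * J)) *
          ENNReal.ofReal (Real.exp (c * (A t - J))) ∂μ := by
        refine lintegral_congr fun t => ?_
        rw [← ENNReal.ofReal_mul (Real.exp_pos _).le, ← Real.exp_add]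
        ring_nf
    _ = ENNReal.ofReal (Real.exp (c * J)) *
          ∫⁻ t in Ioc 0 u, ENNReal.ofReal (Real.exp (c * (A t - J))) ∂μ :=
        lintegral_const_mul' _ _ ENNReal.ofReal_ne_top
    _ ≤ ENNReal.ofReal (Real.exp (c * J)) * ENNReal.ofReal (Real.exp (c * A u) / c) := by
        gcongr
    _ = _ := by
        rw [← ENNReal.ofReal_mul (Real.exp_pos _).le, ← ENNReal.ofReal_mul (by positivity)]
        ring_nf

end LebesgueStieltjes

/-- Tonelli's theorem on the triangle `{t < u}` of `(a, b]²`, with the inner integral enlarged to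
include the diagonal. -/
theorem lintegral_mul_lintegral_Ioc_le {μ : Measure ℝ} {a b : ℝ} [SFinite (μ.restrict (Ioc a b))]
    {f g : ℝ → ℝ≥0∞} (hf : AEMeasurable f (μ.restrict (Ioc a b)))
    (hg : AEMeasurable g (μ.restrict (Ioc a b))) (hf_top : ∀ t, f t ≠ ∞) :
    ∫⁻ t in Ioc a b, f t * ∫⁻ u in Ioc t b, g u ∂μ ∂μ ≤
      ∫⁻ u in Ioc a b, (∫⁻ t in Ioc a u, f t ∂μ) * g u ∂μ := by
  set ν := μ.restrict (Ioc a b) with hν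
  set F : ℝ → ℝ → ℝ≥0∞ := fun t u => {p : ℝ × ℝ | p.1 < p.2}.indicator
    (fun p => f p.1 * g p.2) (t, u) with hF
  have hFm : AEMeasurable (uncurry F) (ν.prod ν) :=
    ((hf.comp_quasiMeasurePreserving Measure.quasiMeasurePreserving_fst).mul
      (hg.comp_quasiMeasurePreserving Measure.quasiMeasurePreserving_snd)).indicator
      (measurableSet_lt measurable_fst measurable_snd)
  calc ∫⁻ t, f t * ∫⁻ u in Ioc t b, g u ∂μ ∂ν = ∫⁻ t, ∫⁻ u, F t u ∂ν ∂ν := by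
        refine setLIntegral_congr_fun measurableSet_Ioc fun t ht => ?_
        have hset : Ioc t b = Ioi t ∩ Ioc a b := by
          ext u
          simp only [mem_Ioc, mem_inter_iff, mem_Ioi]
          exact ⟨fun h => ⟨h.1, ht.1.trans h.1, h.2⟩, fun h => ⟨h.1, h.2.2⟩⟩
        rw [← lintegral_const_mul' _ _ (hf_top t), hset,
          ← Measure.restrict_restrict measurableSet_Ioi, ← lintegral_indicator measurableSet_Ioi]
        rfl
    _ = ∫⁻ u, ∫⁻ t, F t u ∂ν ∂ν := lintegral_lintegral_swap hFm
    _ ≤ ∫⁻ u, (∫⁻ t in Ioc a u, f t ∂μ) * g u ∂ν := by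
        refine setLIntegral_mono_ae' measurableSet_Ioc (Filter.Eventually.of_forall fun u hu => ?_)
        have hfu : AEMeasurable f (μ.restrict (Ioc a u)) :=
          hf.mono_measure (Measure.restrict_mono (Ioc_subset_Ioc_right hu.2) le_rfl)
        rw [← lintegral_mul_const'' _ hfu, hν, ← lintegral_indicator measurableSet_Ioc,
          ← lintegral_indicator measurableSet_Ioc]
        refine lintegral_mono fun t => ?_
        by_cases ht : t ∈ Ioc a b
        · by_cases htu : t < u
          · have : t ∈ Ioc a u := ⟨ht.1, htu.le⟩
            simp [hF, ht, htu, this]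
          · simp [hF, ht, htu]
        · simp [ht]

/-- Fubini-type exponential inequality producing the constant
`e^{(γ−δ)𝔣}/(γ−δ)`. Let `A : [0,T] → ℝ` be nondecreasing, right-continuous, with
all jumps bounded by `𝔣 > 0`, and let `μ_A` be its Lebesgue–Stieltjes measure. Then
for all `γ > δ > 0` and every measurable `φ : [0,T] → [0,∞]`,
`∫_{(0,T]} e^{(γ−δ)·A(t)} (∫_{(t,T]} e^{δ·A(u)} φ(u) dμ_A(u)) dμ_A(t)
  ≤ (e^{(γ−δ)·𝔣}/(γ−δ)) · ∫_{(0,T]} e^{γ·A(u)} φ(u) dμ_A(u)`. -/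
theorem bsvie_fubini_exp_inequality (T : ℝ) (hT : 0 < T) (𝔣 : ℝ) (h𝔣 : 0 < 𝔣)
    (A : ℝ → ℝ)
    (hmono : MonotoneOn A (Icc 0 T))
    (hrc : ∀ t ∈ Ico 0 T, ContinuousWithinAt A (Ici t) t)
    (hjump : ∀ u ∈ Ioc 0 T, A u - leftLim A u ≤ 𝔣)
    (μ : Measure ℝ)
    (hμ : ∀ a b : ℝ, 0 ≤ a → a ≤ b → b ≤ T →
      μ (Ioc a b) = ENNReal.ofReal (A b - A a))
    (γ δ : ℝ) (hδ : 0 < δ) (hδγ : δ < γ)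
    (φ : ℝ → ℝ≥0∞) (hφ : Measurable φ) :
    (∫⁻ t in Ioc 0 T, ENNReal.ofReal (Real.exp ((γ - δ) * A t)) *
        (∫⁻ u in Ioc t T, ENNReal.ofReal (Real.exp (δ * A u)) * φ u ∂μ) ∂μ) ≤
      ENNReal.ofReal (Real.exp ((γ - δ) * 𝔣) / (γ - δ)) *
        ∫⁻ u in Ioc 0 T, ENNReal.ofReal (Real.exp (γ * A u)) * φ u ∂μ := by
  have hc : 0 < γ - δ := sub_pos.2 hδγ
  have hfin : IsFiniteMeasure (μ.restrict (Ioc 0 T)) :=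
    ⟨by simp [hμ 0 T le_rfl hT.le le_rfl]⟩
  have hA : AEMeasurable A (μ.restrict (Ioc 0 T)) :=
    aemeasurable_restrict_of_monotoneOn measurableSet_Ioc (hmono.mono Ioc_subset_Icc_self)
  have hexp : ∀ k : ℝ, AEMeasurable (fun t => ENNReal.ofReal (Real.exp (k * A t)))
      (μ.restrict (Ioc 0 T)) := fun k =>
    (Real.measurable_exp.comp_aemeasurable (hA.const_mul k)).ennreal_ofReal
  refine (lintegral_mul_lintegral_Ioc_le (hexp (γ - δ)) ((hexp δ).mul hφ.aemeasurable)
    fun _ => ENNReal.ofReal_ne_top).trans ?_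
  rw [← lintegral_const_mul' _ _ ENNReal.ofReal_ne_top]
  refine setLIntegral_mono_ae' measurableSet_Ioc (Filter.Eventually.of_forall fun u hu => ?_)
  refine (mul_le_mul_left (lintegral_Ioc_exp_mul_le hmono hrc hjump hμ hc hu) _).trans_eq ?_
  have hsplit : ENNReal.ofReal (Real.exp (γ * A u)) =
      ENNReal.ofReal (Real.exp ((γ - δ) * A u)) * ENNReal.ofReal (Real.exp (δ * A u)) := by
    rw [← ENNReal.ofReal_mul (Real.exp_pos _).le, ← Real.exp_add]
    ring_nf
  rw [hsplit]
  simp only [Pi.mul_apply]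
  ring
end
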